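/- Assume 2 is invertible in R, the map algebraMap R D is injective, h is hermitian, and B : F × F → R is an R-bilinear form satisfying (algebraMap R D)(2·B(u,v)) = h(u,v) + h(v,u) for all u,v ∈ F. Then the algebra (R,F,B,×) (with multiplication (a,u)(b,v) = (ab − B(u,v), a•v + b•u + v×u) on R × F) is flexible if and only if the algebra (D,F,h,×) is flexible, where an algebra is flexible if (x·y)·x = x·(y·x) for all its elements x,y. -/

import Mathlib

/- Context: `R` a commutative unital ring, `D` an associative unital `R`-algebra with a
scalar involution `conj` (i.e. `conj` is `R`-linear, anti-multiplicative, of period 2,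
and all norms `conj x * x` lie in the image of `R`), `F` a right `D`-module (encoded as
a `Dᵐᵒᵖ`-module), `h : F × F → D` a sesquilinear form, and `cross` an alternating
`R`-bilinear map (a cross product).  The `R`-module `A = D × F` carries the
multiplication `(α,u)(β,v) = (αβ − h(v,u), v·α + u·β̄ + v×u)` with unit `(1,0)`.
`σ_A (α,u) = (ᾱ,-u)`, `t_A (α,u) = (ᾱ+α, 0)`, `n_A x = σ_A(x)·x`.
`h` is hermitian if `h u v = conj (h v u)` for all `u v`. -/

open MulOpposite

variable {R D F : Type*} [CommRing R] [Ring D] [Algebra R D]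
  [AddCommGroup F] [Module R F] [Module Dᵐᵒᵖ F] [IsScalarTower R Dᵐᵒᵖ F]

/-- The multiplication of `A = (D,F,h,×)`:
`(α,u)(β,v) = (αβ − h(v,u), v·α + u·β̄ + v×u)`. -/
def amul (conj : D →ₗ[R] D) (h : F → F → D) (cross : F →ₗ[R] F →ₗ[R] F)
    (x y : D × F) : D × F :=
  (x.1 * y.1 - h y.2 x.2,
    op x.1 • y.2 + op (conj y.1) • x.2 + cross y.2 x.2)

/-- The involution `σ_A (α,u) = (ᾱ, -u)`. -/
def sigmaA (conj : D →ₗ[R] D) (x : D × F) : D × F := (conj x.1, -x.2)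

/-- The trace `t_A (α,u) = (ᾱ + α, 0)`. -/
def tA (conj : D →ₗ[R] D) (x : D × F) : D × F := (conj x.1 + x.1, 0)

/-- The multiplication of `(R,F,B,×)`:
`(a,u)(b,v) = (ab − B(u,v), a•v + b•u + v×u)`. -/
def bmul (B : F →ₗ[R] F →ₗ[R] R) (cross : F →ₗ[R] F →ₗ[R] F)
    (x y : R × F) : R × F :=
  (x.1 * y.1 - B x.2 y.2, x.1 • y.2 + y.1 • x.2 + cross y.2 x.2)

theorem conj_one_of_involutive (conj : D →ₗ[R] D)
    (conj_mul : ∀ x y : D, conj (x * y) = conj y * conj x)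
    (conj_conj : ∀ x : D, conj (conj x) = x) : conj 1 = 1 := by
  have h1 := conj_mul (conj 1) 1
  rw [mul_one, conj_conj] at h1
  simpa using h1.symm

/-- The traces of a scalar involution are scalars. -/
theorem exists_conj_eq_sub (conj : D →ₗ[R] D) (conj_one : conj 1 = 1)
    (conj_scalar : ∀ x : D, conj x * x ∈ (algebraMap R D).range) (x : D) :
    ∃ r : R, conj x = algebraMap R D r - x := by
  obtain ⟨p, hp⟩ := conj_scalar (x + 1)
  obtain ⟨q, hq⟩ := conj_scalar x
  refine ⟨p - q - 1, ?_⟩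
  rw [map_sub, map_sub, hp, hq, map_add, conj_one, map_one]
  noncomm_ring

/-- `(R,F,B,×)` is flexible iff `u` is `B`-orthogonal to every `v × u`. -/
theorem bmul_flexible_iff (B : F →ₗ[R] F →ₗ[R] R) (cross : F →ₗ[R] F →ₗ[R] F)
    (cross_alt : ∀ u : F, cross u u = 0) (two_inv : IsUnit (2 : R))
    (B_symm : ∀ u v : F, B u v = B v u) :
    (∀ x y : R × F,
        bmul B cross (bmul B cross x y) x = bmul B cross x (bmul B cross y x)) ↔
      ∀ u v : F, B u (cross v u) = 0 := by
  have anti (u v : F) : cross u v = -cross v u := (LinearMap.IsAlt.neg cross_alt v u).symm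
  constructor
  · intro H u v
    have h1 := congrArg Prod.fst (H (0, u) (0, v))
    simp only [bmul, mul_zero, zero_mul, zero_sub, zero_smul, zero_add, neg_inj] at h1
    rw [anti u v, map_neg, B_symm] at h1
    exact two_inv.mul_right_eq_zero.mp (by linear_combination h1)
  · rintro H ⟨a, u⟩ ⟨b, v⟩
    ext
    · simp only [bmul, map_add, map_smul, LinearMap.add_apply, LinearMap.smul_apply, smul_eq_mul,
        anti u v, map_neg, H, B_symm (cross v u) u, B_symm v u]
      ring
    · simp only [bmul, map_add, map_smul, LinearMap.add_apply, LinearMap.smul_apply, cross_alt,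
        anti u v, anti u (cross v u), map_neg, LinearMap.neg_apply, B_symm v u]
      module

/-- `(D,F,h,×)` is flexible iff `u` is orthogonal to every `v × u` for the symmetrization `B`
of `h`. -/
theorem amul_flexible_iff (conj : D →ₗ[R] D) (h : F → F → D) (cross : F →ₗ[R] F →ₗ[R] F)
    (conj_mul : ∀ x y : D, conj (x * y) = conj y * conj x)
    (conj_conj : ∀ x : D, conj (conj x) = x)
    (conj_scalar : ∀ x : D, conj x * x ∈ (algebraMap R D).range)
    (h_add_left : ∀ u u' v : F, h (u + u') v = h u v + h u' v)
    (h_add_right : ∀ u v v' : F, h u (v + v') = h u v + h u v')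
    (h_sesq : ∀ (a b : D) (u v : F), h (op a • u) (op b • v) = conj a * h u v * b)
    (cross_alt : ∀ u : F, cross u u = 0)
    (two_inv : IsUnit (2 : R))
    (alg_inj : Function.Injective (algebraMap R D))
    (h_herm : ∀ u v : F, h u v = conj (h v u))
    (B : F →ₗ[R] F →ₗ[R] R)
    (hB : ∀ u v : F, (algebraMap R D) (2 * B u v) = h u v + h v u) :
    (∀ x y : D × F,
        amul conj h cross (amul conj h cross x y) x
          = amul conj h cross x (amul conj h cross y x)) ↔
      ∀ u v : F, B u (cross v u) = 0 := by
  have conj_one := conj_one_of_involutive conj conj_mul conj_conj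
  have anti (u v : F) : cross u v = -cross v u := (LinearMap.IsAlt.neg cross_alt v u).symm
  have h_left (a : D) (u v : F) : h (op a • u) v = conj a * h u v := by
    simpa using h_sesq a 1 u v
  have h_right (a : D) (u v : F) : h u (op a • v) = h u v * a := by
    simpa [conj_one] using h_sesq 1 a u v
  have h_neg_left (u v : F) : h (-u) v = -h u v := by
    simpa [conj_one] using h_left (-1) u v
  have h_swap (u v : F) : h v u = algebraMap R D (2 * B u v) - h u v := by
    rw [hB]; abel
  have h_self (u : F) : h u u = algebraMap R D (B u u) := by
    have h2 : (2 : R) • h u u = (2 : R) • algebraMap R D (B u u) := by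
      rw [two_smul, ← hB, map_mul, Algebra.smul_def]
    exact two_inv.smul_left_cancel.mp h2
  have scalar_smul (r : R) (u : F) : op (algebraMap R D r) • u = r • u := by
    rw [← algebraMap_smul Dᵐᵒᵖ r u]; rfl
  have mul_scalar (r : R) (x : D) : x * algebraMap R D r = r • x := by
    rw [← Algebra.commutes, Algebra.smul_def]
  have smul_swap (a : D) (r : R) (u : F) : op a • r • u = r • op a • u := by
    rw [← scalar_smul, smul_smul, ← op_mul, ← Algebra.smul_def, op_smul, smul_assoc]
  constructor
  · intro H u v
    have h1 := congrArg Prod.fst (H (0, u) (0, v))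
    simp only [amul, mul_zero, zero_mul, zero_sub, op_zero, map_zero, zero_smul, zero_add,
      neg_inj] at h1
    rw [anti u v, h_neg_left] at h1
    have h2 : algebraMap R D (2 * B u (cross v u)) = 0 := by
      rw [hB, h1, neg_add_cancel]
    exact two_inv.mul_right_eq_zero.mp (alg_inj (h2.trans (map_zero _).symm))
  · rintro H ⟨α, u⟩ ⟨β, v⟩
    obtain ⟨r, hr⟩ := exists_conj_eq_sub conj conj_one conj_scalar α
    obtain ⟨s, hs⟩ := exists_conj_eq_sub conj conj_one conj_scalar β
    ext
    · simp only [amul, h_add_left, h_add_right, h_left, h_right, conj_conj, anti u v, h_neg_left,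
        h_swap u (cross v u), H, mul_zero, map_zero, h_self, h_swap u v]
      have c1 := Algebra.commutes (B u u) (conj β)
      have c2 := Algebra.commutes (2 * B u v) α
      simp only [mul_sub, sub_mul, mul_assoc, c1, c2]
      abel
    · simp only [amul, map_sub, conj_mul, ← h_herm, hr, hs, smul_add, smul_smul, ← op_mul,
        op_sub, sub_smul, mul_sub, sub_mul, scalar_smul, map_add, map_smul,
        map_neg, LinearMap.add_apply, LinearMap.sub_apply, LinearMap.neg_apply,
        LinearMap.smul_apply, cross_alt, anti u v, smul_neg, anti u (op α • v),
        anti u (op β • u), anti u (cross v u)]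
      simp only [← Algebra.smul_def, mul_scalar, op_smul, smul_assoc, scalar_smul, smul_sub,
        smul_swap, smul_zero, smul_smul, ← op_mul, mul_comm s r]
      abel

/-- assume `2` is invertible in `R`, `algebraMap R D` is injective,
`h` is hermitian, and `B` is an `R`-bilinear form on `F` with
`algebraMap R D (2·B(u,v)) = h(u,v) + h(v,u)`.  Then the algebra `(R,F,B,×)` (on
`R × F` with `(a,u)(b,v) = (ab − B(u,v), a•v + b•u + v×u)`) is flexible if and only
if the algebra `(D,F,h,×)` is flexible. -/
theorem stmt17
    (conj : D →ₗ[R] D) (h : F → F → D) (cross : F →ₗ[R] F →ₗ[R] F)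
    (conj_mul : ∀ x y : D, conj (x * y) = conj y * conj x)
    (conj_conj : ∀ x : D, conj (conj x) = x)
    (conj_scalar : ∀ x : D, conj x * x ∈ (algebraMap R D).range)
    (h_add_left : ∀ u u' v : F, h (u + u') v = h u v + h u' v)
    (h_add_right : ∀ u v v' : F, h u (v + v') = h u v + h u v')
    (h_sesq : ∀ (a b : D) (u v : F), h (op a • u) (op b • v) = conj a * h u v * b)
    (cross_alt : ∀ u : F, cross u u = 0)
    (two_inv : IsUnit (2 : R))
    (alg_inj : Function.Injective (algebraMap R D))
    (h_herm : ∀ u v : F, h u v = conj (h v u))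
    (B : F →ₗ[R] F →ₗ[R] R)
    (hB : ∀ u v : F, (algebraMap R D) (2 * B u v) = h u v + h v u) :
    (∀ x y : R × F,
        bmul B cross (bmul B cross x y) x = bmul B cross x (bmul B cross y x)) ↔
    (∀ x y : D × F,
        amul conj h cross (amul conj h cross x y) x
          = amul conj h cross x (amul conj h cross y x)) := by
  have B_symm (u v : F) : B u v = B v u :=
    two_inv.mul_left_cancel (alg_inj (by rw [hB, hB, add_comm]))
  rw [bmul_flexible_iff B cross cross_alt two_inv B_symm,
    amul_flexible_iff conj h cross conj_mul conj_conj conj_scalar h_add_left h_add_right h_sesq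
      cross_alt two_inv alg_inj h_herm B hB]
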